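/- Let 𝐀 be a regular BBL transformation of bandwidth (p,q) on V_d^S, and let L ≤ R be finite integers with R − L ≥ τ (non-empty bulk). Then the bulk solution space M_{L,R} has dimension exactly dτ, where τ = q' − p'. -/

import Mathlib

noncomputable section

/-- The space of doubly-infinite sequences with values in `ℂ^d`. -/
abbrev SeqSp (d : ℕ) : Type := ℤ → Fin d → ℂ

/-- The shift `(Ψ_j)_j ↦ (Ψ_{j+n})_j`; for `n = 1` this is the left shift `T`. -/
def shiftBy (d : ℕ) (n : ℤ) : Module.End ℂ (SeqSp d) where
  toFun Ψ := fun j => Ψ (j + n)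
  map_add' _ _ := rfl
  map_smul' _ _ := rfl

/-- Entrywise multiplication of a sequence by a fixed `d × d` matrix. -/
def matOp (d : ℕ) (m : Matrix (Fin d) (Fin d) ℂ) : Module.End ℂ (SeqSp d) where
  toFun Ψ := fun j => m.mulVec (Ψ j)
  map_add' Ψ Φ := by funext j; simp [Matrix.mulVec_add]
  map_smul' c Ψ := by funext j; simp [Matrix.mulVec_smul]

/-- The banded block-Laurent (BBL) transformation `(𝐀Ψ)_j = ∑_{r=p}^{q} a_r ψ_{j+r}`. -/
def bbl (d : ℕ) (a : ℤ → Matrix (Fin d) (Fin d) ℂ) (p q : ℤ) : Module.End ℂ (SeqSp d) :=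
  ∑ r ∈ Finset.Icc p q, matOp d (a r) * shiftBy d r

/-- The projection `P_S` replacing every entry with index outside `S` by zero. -/
def projOn (d : ℕ) (S : Set ℤ) : Module.End ℂ (SeqSp d) where
  toFun Ψ := fun j => S.indicator Ψ j
  map_add' Ψ Φ := by
    funext j
    by_cases h : j ∈ S <;> simp [Set.indicator_apply, h]
  map_smul' c Ψ := by
    funext j
    by_cases h : j ∈ S <;> simp [Set.indicator_apply, h]

/-- The window `{j : ℤ | Lb ≤ j ≤ Rb}`, with possibly infinite endpoints. -/
def windowSet (Lb : WithBot ℤ) (Rb : WithTop ℤ) : Set ℤ :=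
  {j : ℤ | Lb ≤ (j : WithBot ℤ) ∧ (j : WithTop ℤ) ≤ Rb}

/-- Sequences supported in `S` (vanishing at every index outside `S`): the space `V_{L,R}`. -/
def suppIn (d : ℕ) (S : Set ℤ) : Submodule ℂ (SeqSp d) where
  carrier := {Ψ | ∀ j ∉ S, Ψ j = 0}
  add_mem' := by
    intro Ψ Φ hΨ hΦ j hj
    simp [Pi.add_apply, hΨ j hj, hΦ j hj]
  zero_mem' := fun j _ => rfl
  smul_mem' := by
    intro c Ψ hΨ j hj
    simp [Pi.smul_apply, hΨ j hj]

/-- Sequences vanishing at every index of `S`. -/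
def vanishOn (d : ℕ) (S : Set ℤ) : Submodule ℂ (SeqSp d) where
  carrier := {Ψ | ∀ j ∈ S, Ψ j = 0}
  add_mem' := by
    intro Ψ Φ hΨ hΦ j hj
    simp [Pi.add_apply, hΨ j hj, hΦ j hj]
  zero_mem' := fun j _ => rfl
  smul_mem' := by
    intro c Ψ hΨ j hj
    simp [Pi.smul_apply, hΨ j hj]

/-- The bulk solution space `M_{Lb,Rb} = Ker (P_{Lb−p',Rb−q'} 𝐀 |_{V_{Lb,Rb}})`, viewed as a
submodule of the full sequence space: sequences supported in the window `[Lb,Rb]` whose image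
under `𝐀` vanishes on the bulk window `[Lb−p', Rb−q']` (with `p' = min p 0`, `q' = max q 0`). -/
def bulkSol (d : ℕ) (a : ℤ → Matrix (Fin d) (Fin d) ℂ) (p q : ℤ)
    (Lb : WithBot ℤ) (Rb : WithTop ℤ) : Submodule ℂ (SeqSp d) :=
  suppIn d (windowSet Lb Rb) ⊓
    (vanishOn d (windowSet (Lb + ((-min p 0 : ℤ) : WithBot ℤ))
        (Rb + ((-max q 0 : ℤ) : WithTop ℤ)))).comap (bbl d a p q)

/-- Falling-factorial type product `j^{(v)} = (j−v+1)(j−v+2)⋯j`. -/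
def ff (j : ℤ) (v : ℕ) : ℤ := ∏ i ∈ Finset.range v, (j - i)

/-- The scalar sequence `Φ_{z,v}`, with `j`-th entry `j^{(v−1)} z^{j−v+1}`, and `Φ_{z,0} = 0`. -/
def Phi (z : ℂ) (v : ℕ) : ℤ → ℂ :=
  fun j => if v = 0 then 0 else (ff j (v - 1) : ℂ) * z ^ (j - (v : ℤ) + 1)

/-- The vector sequence `Φ_{z,v}|m⟩`. -/
def PhiVec (d : ℕ) (z : ℂ) (v : ℕ) (m : Fin d) : SeqSp d :=
  fun j => Phi z v j • (Pi.single m 1 : Fin d → ℂ)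

/-- The subspace `T_{z,s} = Span{Φ_{z,v}|m⟩ : 1 ≤ v ≤ s, 1 ≤ m ≤ d}`. -/
def Tspace (d : ℕ) (z : ℂ) (s : ℕ) : Submodule ℂ (SeqSp d) :=
  Submodule.span ℂ {Ψ : SeqSp d | ∃ v ∈ Finset.Icc 1 s, ∃ m : Fin d, Ψ = PhiVec d z v m}

/-- The symbol `A(w,w⁻¹) = ∑_{r=p}^q w^r a_r` as a matrix of Laurent polynomials. -/
def symbol (d : ℕ) (a : ℤ → Matrix (Fin d) (Fin d) ℂ) (p q : ℤ) :
    Matrix (Fin d) (Fin d) (LaurentPolynomial ℂ) :=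
  ∑ r ∈ Finset.Icc p q, (LaurentPolynomial.T r : LaurentPolynomial ℂ) • (a r).map (fun c => LaurentPolynomial.C c)

/-- The evaluation `A(z,z⁻¹) = ∑_{r=p}^q z^r a_r` of the symbol at `z ≠ 0`. -/
def symbolEval (d : ℕ) (a : ℤ → Matrix (Fin d) (Fin d) ℂ) (p q : ℤ) (z : ℂ) :
    Matrix (Fin d) (Fin d) ℂ :=
  ∑ r ∈ Finset.Icc p q, z ^ r • a r

/-- The `k`-th derivative `A^{(k)}(z,z⁻¹) = ∑_{r=p}^q r(r−1)⋯(r−k+1) z^{r−k} a_r`. -/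
def symbolDeriv (d : ℕ) (a : ℤ → Matrix (Fin d) (Fin d) ℂ) (p q : ℤ) (k : ℕ) (z : ℂ) :
    Matrix (Fin d) (Fin d) ℂ :=
  ∑ r ∈ Finset.Icc p q, ((ff r k : ℂ) * z ^ (r - (k : ℤ))) • a r

/-- The generalized kernel `⋃_k Ker (f^k)` of an endomorphism. -/
def genKer (d : ℕ) (f : Module.End ℂ (SeqSp d)) : Submodule ℂ (SeqSp d) :=
  ⨆ k : ℕ, LinearMap.ker (f ^ k)

/-- `F_L^− `: the generalized kernel of the unilateral shift `P_{L,∞}T` on `M_{L,∞}`. -/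
def Fminus (d : ℕ) (a : ℤ → Matrix (Fin d) (Fin d) ℂ) (p q : ℤ) (L : ℤ) :
    Submodule ℂ (SeqSp d) :=
  bulkSol d a p q (L : WithBot ℤ) ⊤ ⊓
    genKer d (projOn d (windowSet (L : WithBot ℤ) ⊤) * shiftBy d 1)

/-- `F_R^+`: the generalized kernel of the shift `P_{−∞,R}T⁻¹` on `M_{−∞,R}`. -/
def Fplus (d : ℕ) (a : ℤ → Matrix (Fin d) (Fin d) ℂ) (p q : ℤ) (R : ℤ) :
    Submodule ℂ (SeqSp d) :=
  bulkSol d a p q ⊥ (R : WithTop ℤ) ⊓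
    genKer d (projOn d (windowSet ⊥ (R : WithTop ℤ)) * shiftBy d (-1))

/-- The left shift on scalar sequences. -/
def shiftS : Module.End ℂ (ℤ → ℂ) where
  toFun φ := fun j => φ (j + 1)
  map_add' _ _ := rfl
  map_smul' _ _ := rfl

/-- The linear map on `SeqSp d` induced by a diagonal matrix polynomial with diagonal entries
`g m`: it acts on the `m`-th component of a sequence as `g m` evaluated at the left shift. -/
def diagPolyOp (d : ℕ) (g : Fin d → Polynomial ℂ) : Module.End ℂ (SeqSp d) where
  toFun Ψ := fun j m => Polynomial.aeval shiftS (g m) (fun i => Ψ i m) j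
  map_add' Ψ Φ := by
    funext j m
    show Polynomial.aeval shiftS (g m) ((fun i => Ψ i m) + (fun i => Φ i m)) j = _
    rw [map_add]
    rfl
  map_smul' c Ψ := by
    funext j m
    show Polynomial.aeval shiftS (g m) (c • (fun i => Ψ i m)) j = _
    rw [map_smul]
    rfl

/-- The subspace of sequences with values in `Span{|m⟩ : d₀ < m ≤ d}` (the range of `ρ_d(π)`). -/
def piRange (d d₀ : ℕ) : Submodule ℂ (SeqSp d) where
  carrier := {Ψ | ∀ j : ℤ, ∀ m : Fin d, (m : ℕ) < d₀ → Ψ j m = 0}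
  add_mem' := by
    intro Ψ Φ hΨ hΦ j m hm
    simp [Pi.add_apply, hΨ j m hm, hΦ j m hm]
  zero_mem' := fun j m _ => rfl
  smul_mem' := by
    intro c Ψ hΨ j m hm
    simp [Pi.smul_apply, hΨ j m hm]

/-- The Hilbert space `H` of square-summable half-infinite sequences, as a subspace of `SeqSp d`:
sequences vanishing at indices `j ≤ 0` whose restriction to `j ≥ 1` is in `ℓ²`. -/
def Hspace (d : ℕ) : Submodule ℂ (SeqSp d) where
  carrier := {Ψ | (∀ j : ℤ, j ≤ 0 → Ψ j = 0) ∧ Memℓp (fun n : ℕ => Ψ ((n : ℤ) + 1)) 2}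
  add_mem' := by
    intro Ψ Φ hΨ hΦ
    refine ⟨fun j hj => by simp [Pi.add_apply, hΨ.1 j hj, hΦ.1 j hj], ?_⟩
    exact hΨ.2.add hΦ.2
  zero_mem' := ⟨fun j _ => rfl, zero_memℓp⟩
  smul_mem' := by
    intro c Ψ hΨ
    exact ⟨fun j hj => by simp [Pi.smul_apply, hΨ.1 j hj], hΨ.2.const_smul c⟩


lemma mem_windowSet {L R j : ℤ} :
    j ∈ windowSet (L : WithBot ℤ) (R : WithTop ℤ) ↔ j ∈ Finset.Icc L R := by
  simp [windowSet]

lemma bbl_apply (d : ℕ) (a : ℤ → Matrix (Fin d) (Fin d) ℂ) (p q : ℤ) (Ψ : SeqSp d) (j : ℤ) :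
    bbl d a p q Ψ j = ∑ r ∈ Finset.Icc p q, (a r).mulVec (Ψ (j + r)) := by
  simp [bbl, matOp, shiftBy, LinearMap.sum_apply, Finset.sum_apply]

/-- The `n`-th component of the image of a finitely supported row vector under the symbol, acting
from the right, has as coefficients the pairings of that row vector with the images under `𝐀` of
the standard basis sequences. -/
lemma vecMul_symbol_coeff (d : ℕ) (a : ℤ → Matrix (Fin d) (Fin d) ℂ) (p q : ℤ)
    (s : Finset ℤ) (c : ℤ → Fin d → ℂ) (n : Fin d) (k : ℤ) :
    (Matrix.vecMul (fun m => ∑ j ∈ s, (LaurentPolynomial.C (c j m) * LaurentPolynomial.T j :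
        LaurentPolynomial ℂ)) (symbol d a p q) n).coeff k
      = ∑ j ∈ s, ∑ m, c j m * bbl d a p q (Pi.single k (Pi.single n 1)) j m := by
  have hbbl : ∀ j m, bbl d a p q (Pi.single k (Pi.single n 1)) j m
      = ∑ r ∈ Finset.Icc p q, if j + r = k then a r m n else 0 := by
    intro j m
    rw [bbl_apply, Finset.sum_apply]
    refine Finset.sum_congr rfl fun r _ => ?_
    by_cases h : j + r = k <;> simp [h]
  have hmul : Matrix.vecMul (fun m => ∑ j ∈ s, (LaurentPolynomial.C (c j m) *
      LaurentPolynomial.T j : LaurentPolynomial ℂ)) (symbol d a p q) n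
      = ∑ j ∈ s, ∑ m, ∑ r ∈ Finset.Icc p q,
        (AddMonoidAlgebra.single (j + r) (c j m * a r m n) : LaurentPolynomial ℂ) := by
    rw [Finset.sum_comm]
    simp only [Matrix.vecMul, dotProduct, symbol, Matrix.sum_apply, Finset.sum_mul, Finset.mul_sum]
    refine Finset.sum_congr rfl fun m _ => Finset.sum_comm.trans ?_
    refine Finset.sum_congr rfl fun j _ => Finset.sum_congr rfl fun r _ => ?_
    rw [LaurentPolynomial.single_eq_C_mul_T, LaurentPolynomial.T_add, map_mul]
    simp only [Matrix.smul_apply, Matrix.map_apply, smul_eq_mul]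
    ring
  rw [hmul]
  simp only [hbbl, Finset.mul_sum, AddMonoidAlgebra.coeff_sum, Finsupp.finsetSum_apply,
    AddMonoidAlgebra.coeff_single, Finsupp.single_apply, mul_ite, mul_zero]

/-- Extension by zero of a family indexed by a finite set of integers. -/
def extendZero (d : ℕ) (s : Finset ℤ) : (s → Fin d → ℂ) →ₗ[ℂ] SeqSp d where
  toFun x := fun j => if h : j ∈ s then x ⟨j, h⟩ else 0
  map_add' x y := by funext j; by_cases h : j ∈ s <;> simp [h]
  map_smul' c x := by funext j; by_cases h : j ∈ s <;> simp [h]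

lemma extendZero_apply_mem {d : ℕ} {s : Finset ℤ} (x : s → Fin d → ℂ) (j : s) :
    extendZero d s x j = x j := by
  simp [extendZero]

lemma extendZero_apply_notMem {d : ℕ} {s : Finset ℤ} (x : s → Fin d → ℂ) {j : ℤ} (h : j ∉ s) :
    extendZero d s x j = 0 := by
  simp [extendZero, h]

lemma extendZero_injective (d : ℕ) (s : Finset ℤ) : Function.Injective (extendZero d s) := by
  intro x y h
  funext j
  rw [← extendZero_apply_mem x j, h, extendZero_apply_mem]

lemma extendZero_restrict {d : ℕ} {s : Finset ℤ} {Ψ : SeqSp d} (h : ∀ j ∉ s, Ψ j = 0) :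
    extendZero d s (fun j => Ψ j) = Ψ := by
  funext j
  by_cases hj : j ∈ s
  · exact extendZero_apply_mem _ ⟨j, hj⟩
  · rw [extendZero_apply_notMem _ hj, h j hj]

/-- The compression of `𝐀` to sequences supported in `s`, observed on `t`. -/
def compress (d : ℕ) (a : ℤ → Matrix (Fin d) (Fin d) ℂ) (p q : ℤ) (s t : Finset ℤ) :
    (s → Fin d → ℂ) →ₗ[ℂ] (t → Fin d → ℂ) :=
  LinearMap.funLeft ℂ (Fin d → ℂ) (Subtype.val : t → ℤ) ∘ₗ bbl d a p q ∘ₗ extendZero d s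

lemma compress_apply (d : ℕ) (a : ℤ → Matrix (Fin d) (Fin d) ℂ) (p q : ℤ) (s t : Finset ℤ)
    (x : s → Fin d → ℂ) (j : t) :
    compress d a p q s t x j = bbl d a p q (extendZero d s x) j := rfl

lemma bulkSol_eq_map_ker (d : ℕ) (a : ℤ → Matrix (Fin d) (Fin d) ℂ) (p q L R : ℤ) :
    bulkSol d a p q (L : WithBot ℤ) (R : WithTop ℤ)
      = (LinearMap.ker (compress d a p q (Finset.Icc L R)
          (Finset.Icc (L - min p 0) (R - max q 0)))).map (extendZero d (Finset.Icc L R)) := by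
  have hbulk : windowSet ((L : WithBot ℤ) + ((-min p 0 : ℤ) : WithBot ℤ))
      ((R : WithTop ℤ) + ((-max q 0 : ℤ) : WithTop ℤ))
      = ↑(Finset.Icc (L - min p 0) (R - max q 0)) := by
    ext j
    rw [← WithBot.coe_add, ← WithTop.coe_add, mem_windowSet, sub_eq_add_neg, sub_eq_add_neg,
      Finset.mem_coe]
  rw [bulkSol, hbulk]
  ext Ψ
  constructor
  · rintro ⟨hs, hv⟩
    have hE := extendZero_restrict (s := Finset.Icc L R) fun j hj =>
      hs j (mt mem_windowSet.1 hj)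
    refine ⟨fun j => Ψ j, ?_, hE⟩
    refine LinearMap.mem_ker.2 (funext fun j => ?_)
    rw [compress_apply, hE]
    exact hv j j.2
  · rintro ⟨x, hx, rfl⟩
    refine ⟨fun j hj => extendZero_apply_notMem x (mt mem_windowSet.2 hj), fun j hj => ?_⟩
    exact congrFun (LinearMap.mem_ker.1 hx) ⟨j, hj⟩

/-- A regular transformation maps the sequences supported in `s` onto the families on `t`, as soon
as all indices reached from `t` lie in `s`. -/
lemma range_compress_eq_top (d : ℕ) (a : ℤ → Matrix (Fin d) (Fin d) ℂ) (p q : ℤ)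
    (hreg : (symbol d a p q).det ≠ 0) (s t : Finset ℤ)
    (hst : ∀ j ∈ t, ∀ r ∈ Finset.Icc p q, j + r ∈ s) :
    LinearMap.range (compress d a p q s t) = ⊤ := by
  by_contra hne
  obtain ⟨φ, hφ0, hφ⟩ := Submodule.exists_le_ker_of_lt_top _ (lt_top_iff_ne_top.2 hne)
  set c : ℤ → Fin d → ℂ :=
    extendZero d t fun j m => φ (Pi.single j (Pi.single m 1)) with hc
  have hφc : ∀ y : SeqSp d, φ (fun j => y j) = ∑ j ∈ t, ∑ m, c j m * y j m := by
    intro y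
    rw [← Finset.sum_coe_sort t]
    simp only [hc, extendZero_apply_mem]
    have hy : (fun j : t => y j)
        = ∑ j : t, ∑ m, y j m • (Pi.single j (Pi.single m 1) : t → Fin d → ℂ) := by
      funext j m
      simp only [Finset.sum_apply, Pi.smul_apply, Pi.single_apply]
      rw [Finset.sum_eq_single j (by
        intro i _ hi
        simp [hi.symm]) (by simp)]
      simp [Pi.single_apply]
    rw [hy]
    simp only [map_sum, map_smul, smul_eq_mul, mul_comm]
  refine hφ0 (LinearMap.ext fun y => ?_)
  have hzero : Matrix.vecMul (fun m => ∑ j ∈ t, (LaurentPolynomial.C (c j m) *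
      LaurentPolynomial.T j : LaurentPolynomial ℂ)) (symbol d a p q) = 0 := by
    funext n
    refine AddMonoidAlgebra.ext (Finsupp.ext fun k => ?_)
    refine (vecMul_symbol_coeff d a p q t c n k).trans ?_
    rw [← hφc]
    by_cases hk : k ∈ s
    · have hE := extendZero_restrict (s := s)
        (Ψ := (Pi.single k (Pi.single n 1) : SeqSp d)) fun j hj =>
          Pi.single_eq_of_ne (ne_of_mem_of_not_mem hk hj).symm _
      rw [← hE]
      exact hφ ⟨_, rfl⟩
    · refine (congrArg φ (funext fun j => ?_)).trans (map_zero φ)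
      rw [bbl_apply]
      refine Finset.sum_eq_zero fun r hr => ?_
      rw [Pi.single_eq_of_ne (ne_of_mem_of_not_mem (hst j j.2 r hr) hk), Matrix.mulVec_zero]
  have hv := Matrix.eq_zero_of_vecMul_eq_zero hreg hzero
  have hcoeff : ∀ j ∈ t, ∀ m, c j m = 0 := by
    intro i hi m
    have := congrArg (fun f : LaurentPolynomial ℂ => f.coeff i) (congrFun hv m)
    simp only [← LaurentPolynomial.single_eq_C_mul_T] at this
    simpa [AddMonoidAlgebra.coeff_sum, Finsupp.single_apply, hi,
      -LaurentPolynomial.single_eq_C_mul_T] using this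
  have hy := hφc (extendZero d t y)
  simp only [extendZero_apply_mem] at hy
  refine hy.trans (Finset.sum_eq_zero fun j hj => Finset.sum_eq_zero fun m _ => ?_)
  rw [hcoeff j hj m, zero_mul]

theorem stmt_3 (d : ℕ) (hd : 1 ≤ d) (p q : ℤ) (hpq : p ≤ q)
    (a : ℤ → Matrix (Fin d) (Fin d) ℂ) (hap : a p ≠ 0) (haq : a q ≠ 0)
    (hreg : (symbol d a p q).det ≠ 0)
    (L R : ℤ) (hN : max q 0 - min p 0 ≤ R - L) :
    (Module.finrank ℂ ↥(bulkSol d a p q (L : WithBot ℤ) (R : WithTop ℤ)) : ℤ)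
      = d * (max q 0 - min p 0) := by
  have hrange := range_compress_eq_top d a p q hreg (Finset.Icc L R)
    (Finset.Icc (L - min p 0) (R - max q 0)) (by
      intro j hj r hr
      simp only [Finset.mem_Icc] at hj hr ⊢
      omega)
  have hrk := LinearMap.finrank_range_add_finrank_ker (compress d a p q (Finset.Icc L R)
    (Finset.Icc (L - min p 0) (R - max q 0)))
  rw [hrange, finrank_top] at hrk
  simp only [Module.finrank_pi_fintype, Module.finrank_self, Finset.sum_const, Finset.card_univ,
    Fintype.card_coe, Fintype.card_fin, Int.card_Icc, smul_eq_mul, mul_one] at hrk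
  rw [bulkSol_eq_map_ker, ← (Submodule.equivMapOfInjective _ (extendZero_injective d _) _).finrank_eq]
  zify at hrk
  rw [Int.toNat_of_nonneg (by omega), Int.toNat_of_nonneg (by omega)] at hrk
  linear_combination hrk

end
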